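/- A cubic (3-regular) finite simple graph G admits a DET:OLD set if and only if G contains no cycle of length 4. -/

import Mathlib

open SimpleGraph Finset

def detOLD {V : Type*} [Fintype V] [DecidableEq V] (G : SimpleGraph V) [DecidableRel G.Adj]
    (S : Finset V) : Prop :=
  (∀ v : V, 2 ≤ (G.neighborFinset v ∩ S).card) ∧
  ∀ u v : V, u ≠ v →
    2 ≤ ((G.neighborFinset u ∩ S) \ (G.neighborFinset v ∩ S)).card ∨
    2 ≤ ((G.neighborFinset v ∩ S) \ (G.neighborFinset u ∩ S)).card

theorem SimpleGraph.exists_isCycle_length_eq_four_iff {V : Type*} [Fintype V] [DecidableEq V]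
    (G : SimpleGraph V) [DecidableRel G.Adj] :
    (∃ (v : V) (c : G.Walk v v), c.IsCycle ∧ c.length = 4) ↔
      ∃ u v : V, u ≠ v ∧ 2 ≤ (G.neighborFinset u ∩ G.neighborFinset v).card := by
  constructor
  · rintro ⟨u, c, hc, hl⟩
    match c, hc, hl with
    | .cons (v := x) hux (.cons (v := v) hxv (.cons (v := y) hvy (.cons hyu .nil))), hc, _ =>
      have hnd := hc.support_nodup
      simp only [Walk.support_cons, Walk.support_nil, List.tail_cons, List.nodup_cons,
        List.mem_cons, List.not_mem_nil, or_false, not_or] at hnd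
      refine ⟨u, v, Ne.symm hnd.2.1.2, Finset.one_lt_card.2 ⟨x, ?_, y, ?_, hnd.1.2.1⟩⟩
      · simpa using ⟨hux, hxv.symm⟩
      · simpa using ⟨hyu.symm, hvy⟩
  · rintro ⟨u, v, huv, h⟩
    obtain ⟨x, hx, y, hy, hxy⟩ := Finset.one_lt_card.1 h
    simp only [Finset.mem_inter, mem_neighborFinset] at hx hy
    refine ⟨u, .cons hx.1 (.cons hx.2.symm (.cons hy.2 (.cons hy.1.symm .nil))), ?_, rfl⟩
    have hux := hx.1.ne
    have hvx := hx.2.ne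
    have huy := hy.1.ne
    have hvy := hy.2.ne
    simp only [Walk.cons_isCycle_iff, Walk.cons_isPath_iff, Walk.support_cons, Walk.support_nil,
      Walk.edges_cons, Walk.edges_nil, List.mem_cons, List.not_mem_nil, Sym2.eq_iff]
    grind [Walk.IsPath.nil]

theorem stmt6 {V : Type*} [Fintype V] [DecidableEq V] (G : SimpleGraph V) [DecidableRel G.Adj]
    (hcubic : ∀ v : V, G.degree v = 3) :
    (∃ S : Finset V, detOLD G S) ↔
      ¬ ∃ (v : V) (c : G.Walk v v), c.IsCycle ∧ c.length = 4 := by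
  rw [G.exists_isCycle_length_eq_four_iff]
  have hsplit (u v : V) : (G.neighborFinset u \ G.neighborFinset v).card +
      (G.neighborFinset u ∩ G.neighborFinset v).card = 3 := by
    rw [Finset.card_sdiff_add_card_inter, card_neighborFinset_eq_degree, hcubic]
  constructor
  · rintro ⟨S, -, hS⟩ ⟨u, v, huv, h⟩
    have hle (a b : V) : ((G.neighborFinset a ∩ S) \ (G.neighborFinset b ∩ S)).card ≤
        (G.neighborFinset a \ G.neighborFinset b).card :=
      Finset.card_le_card fun x hx => by
        simp only [Finset.mem_sdiff, Finset.mem_inter] at hx ⊢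
        tauto
    have huv_split := hsplit u v
    have hvu_split := hsplit v u
    rw [Finset.inter_comm] at hvu_split
    have := hle u v
    have := hle v u
    have := hS u v huv
    omega
  · intro h
    refine ⟨Finset.univ, fun v => ?_, fun u v huv => Or.inl ?_⟩
    · rw [Finset.inter_univ, card_neighborFinset_eq_degree, hcubic]
      norm_num
    · have hlt : ¬ 2 ≤ (G.neighborFinset u ∩ G.neighborFinset v).card :=
        fun hc => h ⟨u, v, huv, hc⟩
      have := hsplit u v
      rw [Finset.inter_univ, Finset.inter_univ]
      omega
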